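/- arXiv:2006.04957 — 2 statements merged into one kernel-verified Lean document; each statement's English description precedes it below -/
import Mathlib

section
/- Fix positive integers k and d and a permutation σ ∈ S_k. There exists a multivariate polynomial Q with rational coefficients in the variables x_0, x_1, …, x_{dk}, whose weighted total degree is at most dk when x_0 is given weight 1 and x_i is given weight i for i ≥ 1, such that for every positive integer n and every permutation π ∈ S_n, the sum of N_σ(π')^d over all π' in the conjugacy class C_π of π equals |C_π| · Q(n, m_1(π), m_2(π), …, m_{dk}(π)). -/
/-!
Formalization of statements from "Stable characters from permutation patterns"
by C. Gaetz and C. Ryba.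
-/

open scoped Classical

noncomputable section

/-- A word `I` (with values in a linear order `M`) is `σ`-sorted:
`I a < I b` if and only if `σ a < σ b`. -/
def IsSorted {k : ℕ} {M : Type*} [LinearOrder M] (σ : Fin k → Fin k) (I : Fin k → M) : Prop :=
  ∀ a b : Fin k, I a < I b ↔ σ a < σ b

/-- `N_σ(g)`: the number of strictly increasing words `I : Fin k → Fin n` such that
`g ∘ I` is `σ`-sorted, i.e. the number of occurrences of the pattern `σ` in `g`. -/
def patCount (k n : ℕ) (σ : Fin k → Fin k) (g : Equiv.Perm (Fin n)) : ℕ :=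
  Nat.card {I : Fin k → Fin n // StrictMono I ∧ IsSorted σ (⇑g ∘ I)}

/-- `m_i(g)`: the number of cycles of length `i` in the cycle decomposition of `g`,
where fixed points count as cycles of length 1. -/
def cycleCount {n : ℕ} (g : Equiv.Perm (Fin n)) (i : ℕ) : ℕ :=
  if i = 1 then Nat.card {x : Fin n // g x = x} else Multiset.count i g.cycleType

/-- `W k n`: the space of `ℂ`-valued functions on words, a model of the `k`-th tensor power
of the permutation representation of `S_n`. -/
abbrev W (k n : ℕ) := (Fin k → Fin n) → ℂ

/-- The labelling `ℓ_{J,I}` of `Fin k ⊕ Fin k` determined by the words `J` and `I`: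
unprimed vertices (`inl`) get labels from `J`, primed vertices (`inr`) from `I`. -/
def label {k n : ℕ} (J I : Fin k → Fin n) : Fin k ⊕ Fin k → Fin n := Sum.elim J I

/-- `C_P(J, I)`: equal to `1` if the labelling `ℓ_{J,I}` is constant on every part of the
set partition `P` (i.e. every part is monochromatic), and `0` otherwise. -/
def CP {k n : ℕ} (P : Setoid (Fin k ⊕ Fin k)) (J I : Fin k → Fin n) : ℂ :=
  if ∀ a b, P.r a b → label J I a = label J I b then 1 else 0

/-- `C'_P(J, I)`: equal to `1` if the labelling `ℓ_{J,I}` is constant on every part of `P`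
and takes distinct values on distinct parts of `P`, and `0` otherwise. -/
def CP' {k n : ℕ} (P : Setoid (Fin k ⊕ Fin k)) (J I : Fin k → Fin n) : ℂ :=
  if (∀ a b, P.r a b → label J I a = label J I b) ∧
      (∀ a b, ¬ P.r a b → label J I a ≠ label J I b) then 1 else 0

/-- The operator `T_P : W_{k,n} → W_{k,n}`, `(T_P f)(J) = Σ_I C_P(J,I) f(I)`. -/
def TP (k n : ℕ) (P : Setoid (Fin k ⊕ Fin k)) : W k n →ₗ[ℂ] W k n :=
  Matrix.mulVecLin (Matrix.of fun J I => CP P J I)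

/-- The operator `T'_P : W_{k,n} → W_{k,n}`, `(T'_P f)(J) = Σ_I C'_P(J,I) f(I)`. -/
def TP' (k n : ℕ) (P : Setoid (Fin k ⊕ Fin k)) : W k n →ₗ[ℂ] W k n :=
  Matrix.mulVecLin (Matrix.of fun J I => CP' P J I)

/-- The action `ρ(g)` of `S_n` on `W k n`: `(ρ(g) f)(I) = f(g⁻¹ ∘ I)`. -/
def rho (k n : ℕ) (g : Equiv.Perm (Fin n)) : W k n →ₗ[ℂ] W k n where
  toFun f := fun I => f (⇑g⁻¹ ∘ I)
  map_add' _ _ := rfl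
  map_smul' _ _ := rfl

/-- The map `E_σ : ℂ → W_{k,n}` sending `1` to the sum of `v_I` over `σ`-sorted words `I`. -/
def Esig (k n : ℕ) (σ : Fin k → Fin k) : ℂ →ₗ[ℂ] W k n where
  toFun c := fun I => if IsSorted σ I then c else 0
  map_add' a b := by
    funext I; by_cases h : IsSorted σ I <;> simp [h]
  map_smul' a b := by
    funext I; by_cases h : IsSorted σ I <;> simp [h]

/-- The transpose map `E_σ^T : W_{k,n} → ℂ`, `f ↦ Σ_{I σ-sorted} f(I)`. -/
def EsigT (k n : ℕ) (σ : Fin k → Fin k) : W k n →ₗ[ℂ] ℂ where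
  toFun f := ∑ I ∈ Finset.univ.filter (fun I : Fin k → Fin n => IsSorted σ I), f I
  map_add' f g := Finset.sum_add_distrib
  map_smul' c f := by simp [Finset.mul_sum]

/-- There are finitely many set partitions (equivalence relations) on a finite type. -/
noncomputable instance {α : Type*} [Finite α] : Fintype (Setoid α) := by
  have : Finite (Setoid α) :=
    Finite.of_injective (fun s : Setoid α => s.r)
      (fun s t h => by cases s; cases t; cases h; rfl)
  exact Fintype.ofFinite _

namespace PMP
open Equiv

/-- The weights of the variables. -/
def wt (M : ℕ) : Fin (M + 1) → ℕ := fun i => if (i : ℕ) = 0 then 1 else (i : ℕ)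

/-- The evaluation point attached to a permutation. -/
def pt (M n : ℕ) (g : Perm (Fin n)) : Fin (M + 1) → ℚ :=
  fun i => if (i : ℕ) = 0 then (n : ℚ) else (cycleCount g (i : ℕ) : ℚ)

/-- Functions given by polynomials of weighted degree at most `D`. -/
def Good (M D : ℕ) (f : ∀ n, Perm (Fin n) → ℚ) : Prop :=
  ∃ Q : MvPolynomial (Fin (M + 1)) ℚ, MvPolynomial.weightedTotalDegree (wt M) Q ≤ D ∧
    ∀ n (g : Perm (Fin n)), f n g = MvPolynomial.eval (pt M n g) Q

theorem wtd_le_iff {M D : ℕ} {Q : MvPolynomial (Fin (M + 1)) ℚ} :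
    MvPolynomial.weightedTotalDegree (wt M) Q ≤ D ↔
      ∀ m ∈ Q.support, Finsupp.weight (wt M) m ≤ D := by
  simp only [MvPolynomial.weightedTotalDegree, Finset.sup_le_iff]

theorem Good.mono {M D D' : ℕ} {f} (h : Good M D f) (hD : D ≤ D') : Good M D' f := by
  obtain ⟨Q, h1, h2⟩ := h
  exact ⟨Q, h1.trans hD, h2⟩

theorem Good.congr {M D : ℕ} {f f'} (h : Good M D f) (hf : ∀ n g, f' n g = f n g) :
    Good M D f' := by
  obtain ⟨Q, h1, h2⟩ := h
  exact ⟨Q, h1, fun n g => (hf n g).trans (h2 n g)⟩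

theorem Good.add {M D : ℕ} {f f'} (h : Good M D f) (h' : Good M D f') :
    Good M D (fun n g => f n g + f' n g) := by
  obtain ⟨Q, h1, h2⟩ := h
  obtain ⟨Q', h1', h2'⟩ := h'
  refine ⟨Q + Q', ?_, fun n g => by simp [h2, h2']⟩
  rw [wtd_le_iff] at *
  intro m hm
  rcases Finset.mem_union.1 (MvPolynomial.support_add hm) with h | h
  · exact h1 _ h
  · exact h1' _ h

theorem Good.mul {M D D' : ℕ} {f f'} (h : Good M D f) (h' : Good M D' f') :
    Good M (D + D') (fun n g => f n g * f' n g) := by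
  obtain ⟨Q, h1, h2⟩ := h
  obtain ⟨Q', h1', h2'⟩ := h'
  refine ⟨Q * Q', ?_, fun n g => by simp [h2, h2']⟩
  rw [wtd_le_iff] at *
  intro m hm
  obtain ⟨a, ha, b, hb, rfl⟩ := Finset.mem_add.1 (MvPolynomial.support_mul _ _ hm)
  rw [map_add]
  exact Nat.add_le_add (h1 _ ha) (h1' _ hb)

theorem Good.const (M D : ℕ) (c : ℚ) : Good M D (fun _ _ => c) := by
  refine ⟨MvPolynomial.C c, ?_, fun n g => by simp⟩
  rw [wtd_le_iff]
  intro m hm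
  have : m = 0 := by
    by_contra h
    rw [MvPolynomial.mem_support_iff, MvPolynomial.coeff_C] at hm
    exact hm (if_neg (Ne.symm h))
  simp [this]

theorem Good.var (M : ℕ) (i : Fin (M + 1)) : Good M (wt M i) (fun n g => pt M n g i) := by
  refine ⟨MvPolynomial.X i, ?_, fun n g => by simp⟩
  rw [wtd_le_iff]
  intro m hm
  rw [MvPolynomial.support_X, Finset.mem_singleton] at hm
  simp [hm, Finsupp.weight_apply]

theorem Good.smul {M D : ℕ} {f} (c : ℚ) (h : Good M D f) :
    Good M D (fun n g => c * f n g) := by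
  have := (Good.const M 0 c).mul h
  rwa [zero_add] at this

theorem Good.sub {M D : ℕ} {f f'} (h : Good M D f) (h' : Good M D f') :
    Good M D (fun n g => f n g - f' n g) :=
  (h.add (h'.smul (-1))).congr fun n g => by ring

theorem Good.sum {M D : ℕ} {ι : Type*} (s : Finset ι) {f : ι → ∀ n, Perm (Fin n) → ℚ}
    (h : ∀ i ∈ s, Good M D (f i)) : Good M D (fun n g => ∑ i ∈ s, f i n g) := by
  induction s using Finset.induction_on with
  | empty => exact (Good.const M D 0).congr fun n g => by simp
  | insert a s ha ih =>
    exact ((h a (Finset.mem_insert_self _ _)).add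
      (ih fun i hi => h i (Finset.mem_insert_of_mem hi))).congr
      fun n g => by rw [Finset.sum_insert ha]

theorem Good.n {M D : ℕ} (hD : 1 ≤ D) : Good M D (fun n _ => (n : ℚ)) := by
  refine ((Good.var M 0).mono ?_).congr fun n g => ?_
  · simpa [wt] using hD
  · simp [pt]

theorem Good.cycle {M D i : ℕ} (hi : 1 ≤ i) (hD : i ≤ D) (hM : i ≤ M) :
    Good M D (fun _ g => (cycleCount g i : ℚ)) := by
  refine ((Good.var M ⟨i, by omega⟩).mono ?_).congr fun n g => ?_
  · simp [wt]; split_ifs <;> omega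
  · simp only [pt]; rw [if_neg (by omega)]

theorem card_cycle_eq {n : ℕ} (g : Perm (Fin n)) (i : ℕ) :
    (g.support.filter (fun x => (g.cycleOf x).support.card = i)).card
      = i * g.cycleType.count i := by
  have h1 : g.support.filter (fun x => (g.cycleOf x).support.card = i)
      = (g.cycleFactorsFinset.filter (fun f => f.support.card = i)).biUnion
          (fun f => f.support) := by
    ext x
    simp only [Finset.mem_filter, Finset.mem_biUnion]
    constructor
    · rintro ⟨hx, h⟩
      refine ⟨g.cycleOf x, ⟨Perm.cycleOf_mem_cycleFactorsFinset_iff.2 hx, h⟩, ?_⟩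
      rw [Perm.mem_support_cycleOf_iff]
      exact ⟨Perm.SameCycle.refl _ _, hx⟩
    · rintro ⟨f, ⟨hf, h⟩, hx⟩
      have : f = g.cycleOf x := Perm.cycle_is_cycleOf hx hf
      subst this
      exact ⟨Perm.mem_cycleFactorsFinset_support_le hf hx, h⟩
  rw [h1, Finset.card_biUnion]
  · rw [Finset.sum_congr rfl (g := fun _ => i) (fun f hf => (Finset.mem_filter.1 hf).2)]
    rw [Finset.sum_const, smul_eq_mul, mul_comm, Perm.cycleType_def, Multiset.count_map]
    congr 1
    rw [Finset.card_def, Finset.filter_val]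
    congr 1
    apply Multiset.filter_congr
    intro f _
    simp [eq_comm]
  · intro a ha b hb hab
    have := g.cycleFactorsFinset_pairwise_disjoint (Finset.mem_filter.1 ha).1
      (Finset.mem_filter.1 hb).1 hab
    exact this.disjoint_support

theorem card_fix_pow {n : ℕ} (g : Perm (Fin n)) (c : ℕ) (hc : 1 ≤ c) :
    Nat.card {x : Fin n // (g ^ c) x = x}
      = ∑ i ∈ c.divisors, i * cycleCount g i := by
  have h0 : Nat.card {x : Fin n // (g ^ c) x = x}
      = (Finset.univ.filter (fun x => (g ^ c) x = x)).card := by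
    rw [Nat.card_eq_fintype_card, Fintype.card_subtype]
  rw [h0]
  have h1 : Finset.univ.filter (fun x => (g ^ c) x = x) =
      c.divisors.biUnion (fun i => if i = 1 then Finset.univ.filter (fun x => g x = x)
        else g.support.filter (fun x => (g.cycleOf x).support.card = i)) := by
    ext x
    simp only [Finset.mem_filter, Finset.mem_univ, true_and, Finset.mem_biUnion, Nat.mem_divisors]
    by_cases hx : g x = x
    · simp only [Perm.pow_apply_eq_self_of_apply_eq_self hx, true_iff]
      exact ⟨1, ⟨one_dvd _, by omega⟩, by simp [hx]⟩
    · have hx' : x ∈ g.support := Perm.mem_support.2 hx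
      have hcyc := Perm.isCycleOn_support_cycleOf g x
      rw [hcyc.pow_apply_eq (by rw [Perm.mem_support_cycleOf_iff]
                                exact ⟨Perm.SameCycle.refl _ _, hx'⟩)]
      constructor
      · intro h
        refine ⟨_, ⟨h, by omega⟩, ?_⟩
        have := Perm.two_le_card_support_cycleOf_iff.2 hx
        rw [if_neg (by omega)]
        simp [hx]
      · rintro ⟨i, ⟨hi, -⟩, h⟩
        split_ifs at h with h1
        · simp [hx] at h
        · rw [(Finset.mem_filter.1 h).2]; exact hi
  rw [h1, Finset.card_biUnion]
  · refine Finset.sum_congr rfl fun i _ => ?_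
    by_cases hi : i = 1
    · rw [if_pos hi]
      subst hi
      simp only [cycleCount, if_true, one_mul]
      rw [Nat.card_eq_fintype_card, Fintype.card_subtype]
    · rw [if_neg hi, card_cycle_eq]
      simp only [cycleCount, if_neg hi]
  · intro a _ b _ hab
    refine Finset.disjoint_left.2 ?_
    intro x hxa hxb
    dsimp only at hxa hxb
    split_ifs at hxa hxb <;> simp_all

theorem Good.fix {M D c : ℕ} (hc : 1 ≤ c) (hD : c ≤ D) (hM : c ≤ M) :
    Good M D (fun n g => (Nat.card {x : Fin n // (g ^ c) x = x} : ℚ)) := by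
  refine (Good.sum c.divisors (f := fun i n g => (i : ℚ) * (cycleCount g i : ℚ))
    fun i hi => ?_).congr fun n g => ?_
  · have := Nat.divisor_le hi
    have := Nat.pos_of_mem_divisors hi
    exact (Good.cycle (by omega) (by omega) (by omega)).smul _
  · rw [card_fix_pow g c hc]; push_cast; rfl

/-- Words intertwining a permutation `t` of the index set with powers of `g`. -/
abbrev SolP {K : Type} (t : Perm K) (w : K → ℕ) (n : ℕ) (g : Perm (Fin n)) : Type :=
  {I : K → Fin n // ∀ a, I a = (g ^ (w a)) (I (t a))}

theorem solP_option_fixed {K : Type} (t : Perm (Option K)) (w : Option K → ℕ)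
    (ht : t none = none) (n : ℕ) (g : Perm (Fin n)) :
    Nat.card (SolP t w n g) = Nat.card {x : Fin n // (g ^ (w none)) x = x} *
      Nat.card (SolP (removeNone t) (fun a => w (some a)) n g) := by
  have hs : ∀ a, t (some a) = some (removeNone t a) := by
    intro a
    rw [removeNone_some]
    rw [← Option.ne_none_iff_exists']
    intro h
    have := t.injective (h.trans ht.symm)
    simp at this
  rw [← Nat.card_prod]
  refine Nat.card_congr ⟨fun I => (⟨I.1 none, ?_⟩, ⟨fun a => I.1 (some a), ?_⟩),
    fun p => ⟨fun o => o.elim p.1.1 p.2.1, ?_⟩, ?_, ?_⟩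
  · have := I.2 none
    rw [ht] at this
    exact this.symm
  · intro a
    have := I.2 (some a)
    rw [hs] at this
    exact this
  · rintro (_ | a)
    · rw [ht]; exact p.1.2.symm
    · rw [hs]; exact p.2.2 a
  · intro I
    apply Subtype.ext
    funext o
    cases o <;> rfl
  · intro p
    rfl

theorem solP_option_moved {K : Type} (t : Perm (Option K)) (w : Option K → ℕ)
    (b c : K) (hc : t none = some c) (hb : t (some b) = none) (n : ℕ) (g : Perm (Fin n)) :
    Nat.card (SolP t w n g) =
      Nat.card (SolP (removeNone t)
        (fun a => w (some a) + if a = b then w none else 0) n g) := by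
  have hs : ∀ a, a ≠ b → t (some a) = some (removeNone t a) := by
    intro a hab
    rw [removeNone_some]
    rw [← Option.ne_none_iff_exists']
    intro h
    have := t.injective (h.trans hb.symm)
    exact hab (Option.some_injective _ this)
  have hbc : removeNone t b = c := by
    have := removeNone_none t hb
    rw [hc] at this
    exact Option.some_injective _ this
  refine Nat.card_congr ⟨fun I => ⟨fun a => I.1 (some a), ?_⟩,
    fun I => ⟨fun o => o.elim ((g ^ (w none)) (I.1 c)) I.1, ?_⟩, ?_, ?_⟩
  · intro a
    by_cases hab : a = b
    · subst hab
      have h1 := I.2 (some a)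
      have h2 := I.2 none
      rw [hb] at h1
      rw [hc] at h2
      dsimp only
      rw [hbc, if_pos rfl, pow_add, Perm.mul_apply, ← h2, ← h1]
    · have h1 := I.2 (some a)
      rw [hs a hab] at h1
      simpa [hab] using h1
  · rintro (_ | a)
    · rw [hc]; rfl
    · by_cases hab : a = b
      · subst hab
        have h1 := I.2 a
        dsimp only at h1
        rw [hbc, if_pos rfl, pow_add, Perm.mul_apply] at h1
        rw [hb]
        exact h1
      · rw [hs a hab]
        have h1 := I.2 a
        simpa [hab] using h1
  · intro I
    apply Subtype.ext
    funext o
    cases o with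
    | none =>
      have h2 := I.2 none
      rw [hc] at h2
      exact h2.symm
    | some a => rfl
  · intro I
    rfl

theorem good_perm (M : ℕ) (K : Type) [Finite K] : ∀ [Fintype K] (t : Perm K) (w : K → ℕ),
    (∀ a, 1 ≤ w a) → ∑ a, w a ≤ M →
      Good M (∑ a, w a) (fun n g => (Nat.card (SolP t w n g) : ℚ)) := by
  refine Finite.induction_empty_option (P := fun K => ∀ [Fintype K] (t : Perm K) (w : K → ℕ),
    (∀ a, 1 ≤ w a) → ∑ a, w a ≤ M →
      Good M (∑ a, w a) (fun n g => (Nat.card (SolP t w n g) : ℚ))) ?_ ?_ ?_ K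
  · intro α β e ih _ t w hw hM
    let _ : Fintype α := Fintype.ofEquiv _ e.symm
    have hsum : ∑ a, w (e a) = ∑ b, w b := Equiv.sum_comp e w
    have := ih ((e.trans t).trans e.symm) (fun a => w (e a)) (fun a => hw _) (hsum ▸ hM)
    rw [hsum] at this
    refine this.congr fun n g => ?_
    congr 1
    refine Nat.card_congr ⟨fun I => ⟨fun a => I.1 (e a), ?_⟩,
      fun I => ⟨fun b => I.1 (e.symm b), ?_⟩, ?_, ?_⟩
    · intro a
      simpa using I.2 (e a)
    · intro b
      simpa using I.2 (e.symm b)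
    · intro I; apply Subtype.ext; funext b; simp
    · intro I; apply Subtype.ext; funext b; simp
  · intro _ t w _ _
    refine (Good.const M _ 1).congr fun n g => ?_
    have : Nat.card (SolP t w n g) = 1 := by
      rw [Nat.card_eq_one_iff_unique]
      refine ⟨⟨fun I J => ?_⟩, ⟨⟨fun a => a.elim, fun a => a.elim⟩⟩⟩
      apply Subtype.ext; funext a; exact a.elim
    rw [this]; simp
  · intro α _ ih inst t w hw hM
    have hinst := Subsingleton.elim inst instFintypeOption
    subst hinst
    rw [Fintype.sum_option] at hM ⊢
    by_cases ht : t none = none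
    · refine ((Good.fix (M := M) (hw none) le_rfl (by omega)).mul
        (ih (removeNone t) (fun a => w (some a)) (fun a => hw _) (by omega))).congr
        fun n g => ?_
      rw [solP_option_fixed t w ht]
      push_cast; rfl
    · obtain ⟨c, hc⟩ := Option.ne_none_iff_exists'.1 ht
      have hb0 : t.symm none ≠ none := by
        intro h
        apply ht
        have := t.apply_symm_apply none
        rwa [h] at this
      obtain ⟨b, hb⟩ := Option.ne_none_iff_exists'.1 hb0
      have hb : t (some b) = none := by rw [← hb]; simp
      have hsum : ∑ a, (w (some a) + if a = b then w none else 0)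
          = w none + ∑ a, w (some a) := by
        rw [Finset.sum_add_distrib, Finset.sum_ite_eq']
        simp [add_comm]
      have := ih (removeNone t) (fun a => w (some a) + if a = b then w none else 0)
        (fun a => le_add_right (hw _)) (by omega)
      rw [hsum] at this
      exact this.congr fun n g => by rw [solP_option_moved t w b c hc hb]

/-- Words satisfying equality constraints `E` and constraints `I a = g (I b)` for `S a b`. -/
abbrev Sol {K : Type} (E S : K → K → Prop) (n : ℕ) (g : Perm (Fin n)) : Type :=
  {I : K → Fin n // (∀ a b, E a b → I a = I b) ∧ ∀ a b, S a b → I a = g (I b)}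

theorem sol_merge {K : Type} (E S : K → K → Prop) (a b : K) (hab : b ≠ a) (n : ℕ)
    (g : Perm (Fin n)) (h : ∀ I : Sol E S n g, I.1 a = I.1 b) :
    Nat.card (Sol E S n g) = Nat.card (Sol (K := {x // x ≠ a})
      (Relation.Map E (fun x => if hx : x = a then ⟨b, hab⟩ else ⟨x, hx⟩)
        (fun x => if hx : x = a then ⟨b, hab⟩ else ⟨x, hx⟩))
      (Relation.Map S (fun x => if hx : x = a then ⟨b, hab⟩ else ⟨x, hx⟩)
        (fun x => if hx : x = a then ⟨b, hab⟩ else ⟨x, hx⟩)) n g) := by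
  set f : K → {x // x ≠ a} := fun x => if hx : x = a then ⟨b, hab⟩ else ⟨x, hx⟩ with hf
  have hval : ∀ (I : Sol E S n g) x, I.1 (f x).1 = I.1 x := by
    intro I x
    by_cases hx : x = a
    · simp only [hf, dif_pos hx]; rw [hx]; exact (h I).symm
    · simp only [hf, dif_neg hx]
  refine Nat.card_congr ⟨fun I => ⟨fun x => I.1 x.1, ?_, ?_⟩,
    fun I => ⟨fun x => I.1 (f x), ?_, ?_⟩, ?_, ?_⟩
  · rintro _ _ ⟨p, q, hpq, rfl, rfl⟩
    dsimp only
    rw [hval, hval]; exact I.2.1 p q hpq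
  · rintro _ _ ⟨p, q, hpq, rfl, rfl⟩
    dsimp only
    rw [hval, hval]; exact I.2.2 p q hpq
  · intro p q hpq
    exact I.2.1 _ _ ⟨p, q, hpq, rfl, rfl⟩
  · intro p q hpq
    exact I.2.2 _ _ ⟨p, q, hpq, rfl, rfl⟩
  · intro I; apply Subtype.ext; funext x; exact hval I x
  · intro I; apply Subtype.ext; funext x
    have : f x.1 = x := by simp only [hf, dif_neg x.2]
    show I.1 (f x.1) = _
    rw [this]

theorem sol_isolated {K : Type} (E S : K → K → Prop) (a : K) (hE : ∀ p q, E p q → p = q)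
    (h1 : ∀ b, ¬ S a b) (h2 : ∀ b, ¬ S b a) (n : ℕ) (g : Perm (Fin n)) :
    Nat.card (Sol E S n g) = n * Nat.card (Sol (K := {x // x ≠ a})
      (fun _ _ => False) (fun p q => S p.1 q.1) n g) := by
  have hn : n = Nat.card (Fin n) := by simp
  conv_rhs => enter [1]; rw [hn]
  rw [← Nat.card_prod]
  refine Nat.card_congr ⟨fun I => (I.1 a, ⟨fun x => I.1 x.1, ?_, ?_⟩),
    fun I => ⟨fun x => if hx : x = a then I.1 else I.2.1 ⟨x, hx⟩, ?_, ?_⟩, ?_, ?_⟩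
  · intro _ _ h; exact h.elim
  · intro p q hpq; exact I.2.2 _ _ hpq
  · intro p q hpq; rw [hE p q hpq]
  · intro p q hpq
    have hp : p ≠ a := by rintro rfl; exact h1 _ hpq
    have hq : q ≠ a := by rintro rfl; exact h2 _ hpq
    dsimp only
    rw [dif_neg hp, dif_neg hq]
    exact I.2.2.2 ⟨p, hp⟩ ⟨q, hq⟩ hpq
  · intro I; apply Subtype.ext; funext x
    by_cases hx : x = a
    · subst hx; simp
    · simp [hx]
  · intro I
    refine Prod.ext (by simp) (Subtype.ext ?_)
    funext x
    simp [x.2]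

theorem sol_end {K : Type} (E S : K → K → Prop) (a c : K) (hE : ∀ p q, E p q → p = q)
    (h1 : ∀ b, ¬ S a b) (hc : S c a) (h2 : ∀ b, S b a → b = c) (n : ℕ) (g : Perm (Fin n)) :
    Nat.card (Sol E S n g) = Nat.card (Sol (K := {x // x ≠ a})
      (fun _ _ => False) (fun p q => S p.1 q.1) n g) := by
  have hca : c ≠ a := by rintro rfl; exact h1 _ hc
  refine Nat.card_congr ⟨fun I => ⟨fun x => I.1 x.1, ?_, ?_⟩,
    fun I => ⟨fun x => if hx : x = a then g.symm (I.1 ⟨c, hca⟩) else I.1 ⟨x, hx⟩, ?_, ?_⟩, ?_, ?_⟩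
  · intro _ _ h; exact h.elim
  · intro p q hpq; exact I.2.2 _ _ hpq
  · intro p q hpq; rw [hE p q hpq]
  · intro p q hpq
    have hp : p ≠ a := by rintro rfl; exact h1 _ hpq
    dsimp only
    rw [dif_neg hp]
    by_cases hq : q = a
    · subst hq
      have := h2 p hpq
      subst this
      simp
    · rw [dif_neg hq]
      exact I.2.2 ⟨p, hp⟩ ⟨q, hq⟩ hpq
  · intro I; apply Subtype.ext; funext x
    by_cases hx : x = a
    · subst hx
      have := I.2.2 _ _ hc
      simp [this]
    · simp [hx]
  · intro I
    refine Subtype.ext ?_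
    funext x
    simp [x.2]

theorem good_sol (M : ℕ) : ∀ (N : ℕ) (K : Type) [Fintype K] (E S : K → K → Prop),
    Fintype.card K = N → N ≤ M →
      Good M N (fun n g => (Nat.card (Sol E S n g) : ℚ)) := by
  intro N
  induction N with
  | zero =>
    intro K _ E S hK _
    have : IsEmpty K := Fintype.card_eq_zero_iff.1 hK
    refine (Good.const M _ 1).congr fun n g => ?_
    have : Nat.card (Sol E S n g) = 1 := by
      rw [Nat.card_eq_one_iff_unique]
      refine ⟨⟨fun I J => ?_⟩, ⟨⟨fun a => isEmptyElim a, fun a => isEmptyElim a,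
        fun a => isEmptyElim a⟩⟩⟩
      apply Subtype.ext; funext a; exact isEmptyElim a
    rw [this]; simp
  | succ N ih =>
    intro K _ E S hK hM
    have hcard : ∀ a : K, Fintype.card {x // x ≠ a} = N := by
      intro a
      simp [hK]
    by_cases hm : ∃ a b, b ≠ a ∧ ∀ n g, ∀ I : Sol E S n g, I.1 a = I.1 b
    · obtain ⟨a, b, hab, h⟩ := hm
      exact ((ih {x // x ≠ a} _ _ (hcard a) (by omega)).mono (Nat.le_succ N)).congr
        fun n g => by rw [sol_merge E S a b hab n g (h n g)]
    have hm : ∀ a b, (∀ n g, ∀ I : Sol E S n g, I.1 a = I.1 b) → a = b := by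
      intro a b h
      by_contra hab
      exact hm ⟨a, b, Ne.symm hab, h⟩
    have hE : ∀ p q, E p q → p = q := fun p q h => hm p q fun n g I => I.2.1 _ _ h
    have hS1 : ∀ p p' q, S p q → S p' q → p = p' := fun p p' q h h' =>
      hm p p' fun n g I => (I.2.2 _ _ h).trans (I.2.2 _ _ h').symm
    have hS2 : ∀ p q q', S p q → S p q' → q = q' := fun p q q' h h' =>
      hm q q' fun n g I => g.injective ((I.2.2 _ _ h).symm.trans (I.2.2 _ _ h'))
    by_cases hr : ∃ a, ∀ b, ¬ S a b
    · obtain ⟨a, ha⟩ := hr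
      have ih' := ih {x // x ≠ a} (fun _ _ => False) (fun p q => S p.1 q.1)
        (hcard a) (by omega)
      by_cases hc : ∃ c, S c a
      · obtain ⟨c, hc⟩ := hc
        exact (ih'.mono (Nat.le_succ N)).congr fun n g => by
          rw [sol_end E S a c hE ha hc (fun b hb => hS1 _ _ _ hb hc)]
      · have := (Good.n (M := M) le_rfl).mul ih'
        rw [add_comm] at this
        refine this.congr fun n g => ?_
        rw [sol_isolated E S a hE ha (fun b hb => hc ⟨b, hb⟩)]
        push_cast; rfl
    · push Not at hr
      choose t ht using hr
      have htinj : Function.Injective t := by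
        intro p q hpq
        refine hS1 p q (t p) (ht p) ?_
        rw [hpq]; exact ht q
      let t' : Perm K := Equiv.ofBijective t (Finite.injective_iff_bijective.1 htinj)
      have hg := good_perm M K t' (fun _ => 1) (fun _ => le_rfl)
        (by simp [hK]; omega)
      simp only [Finset.sum_const, Finset.card_univ, hK, smul_eq_mul, mul_one] at hg
      refine hg.congr fun n g => ?_
      congr 1
      refine Nat.card_congr (Equiv.subtypeEquivRight fun I => ?_)
      constructor
      · rintro ⟨-, h⟩ a
        rw [pow_one]; exact h _ _ (ht a)
      · intro h
        refine ⟨fun p q hpq => by rw [hE p q hpq], fun p q hpq => ?_⟩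
        have := h p
        rw [pow_one] at this
        rw [this, hS2 p q (t p) hpq (ht p)]; rfl

/-- The set partition of the two copies of `K` given by coincidences among `I` and `g ∘ I`. -/
def kr {K : Type} {n : ℕ} (g : Perm (Fin n)) (I : K → Fin n) : Setoid (K ⊕ K) :=
  Setoid.ker (Sum.elim I (⇑g ∘ I))

theorem good_le (M : ℕ) (K : Type) [Fintype K] (hM : Fintype.card K ≤ M)
    (P : Setoid (K ⊕ K)) :
    Good M (Fintype.card K)
      (fun n g => ((Finset.univ.filter fun I : K → Fin n => P ≤ kr g I).card : ℚ)) := by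
  refine (good_sol M _ K (fun a b => P (Sum.inl a) (Sum.inl b) ∨ P (Sum.inr a) (Sum.inr b))
    (fun a b => P (Sum.inl a) (Sum.inr b)) rfl hM).congr fun n g => ?_
  congr 1
  rw [← Fintype.card_subtype, ← Nat.card_eq_fintype_card]
  refine Nat.card_congr (Equiv.subtypeEquivRight fun I => ?_)
  rw [Setoid.le_def]
  constructor
  · intro h
    refine ⟨fun a b hab => ?_, fun a b hab => ?_⟩
    · rcases hab with hab | hab
      · exact h hab
      · exact g.injective (h hab)
    · exact h hab
  · rintro ⟨h1, h2⟩ (a | a) (b | b) hab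
    · exact h1 a b (Or.inl hab)
    · exact h2 a b hab
    · exact (h2 b a (P.symm' hab)).symm
    · exact congrArg g (h1 a b (Or.inr hab))

theorem good_exact (M : ℕ) (K : Type) [Fintype K] (hM : Fintype.card K ≤ M)
    (P : Setoid (K ⊕ K)) :
    Good M (Fintype.card K)
      (fun n g => ((Finset.univ.filter fun I : K → Fin n => kr g I = P).card : ℚ)) := by
  induction P using (wellFounded_gt (α := Setoid (K ⊕ K))).induction with
  | _ P ih =>
  refine ((good_le M K hM P).sub
    (Good.sum (Finset.univ.filter fun Q => P < Q) fun Q hQ =>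
      ih Q (Finset.mem_filter.1 hQ).2)).congr fun n g => ?_
  rw [eq_sub_iff_add_eq]
  norm_cast
  have h1 : (Finset.univ.filter fun I : K → Fin n => P ≤ kr g I).card
      = ∑ Q ∈ Finset.univ.filter (fun Q => P ≤ Q),
        (Finset.univ.filter fun I : K → Fin n => kr g I = Q).card := by
    rw [Finset.card_eq_sum_card_fiberwise (f := kr g)
      (t := Finset.univ.filter (fun Q => P ≤ Q))]
    · refine Finset.sum_congr rfl fun Q hQ => ?_
      congr 1
      ext I
      simp only [Finset.mem_filter, Finset.mem_univ, true_and] at hQ ⊢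
      constructor
      · exact fun h => h.2
      · rintro rfl; exact ⟨hQ, rfl⟩
    · intro I hI
      simpa using hI
  have h2 : (Finset.univ.filter (fun Q => P ≤ Q)) =
      insert P (Finset.univ.filter (fun Q => P < Q)) := by
    ext Q
    simp only [Finset.mem_filter, Finset.mem_univ, true_and, Finset.mem_insert]
    rw [le_iff_eq_or_lt, eq_comm]
  rw [h1, h2, Finset.sum_insert (by simp)]

theorem exists_order_equiv {Q : Type} [Fintype Q] {n : ℕ} (j : Q → Fin n)
    (hj : Function.Injective j) :
    ∃ e : Q ≃ Fin (Fintype.card Q), ∀ x y, e x < e y ↔ j x < j y := by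
  let _ : LinearOrder Q := LinearOrder.lift' j hj
  let e := (Fintype.orderIsoFinOfCardEq Q rfl).symm
  refine ⟨e.toEquiv, fun x y => ?_⟩
  exact e.lt_iff_lt

theorem exists_prob {V : Type} [Fintype V] (cond : ∀ n, (V → Fin n) → Prop)
    (hcond : ∀ n m (L : V → Fin n) (L' : V → Fin m), (∀ x y, L x < L y ↔ L' x < L' y) →
      (cond n L ↔ cond m L')) :
    ∃ c : Setoid V → ℚ, ∀ n (L : V → Fin n),
      ∑ h : Perm (Fin n), (if cond n (⇑h ∘ L) then (1 : ℚ) else 0)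
        = (n.factorial : ℚ) * c (Setoid.ker L) := by
  refine ⟨fun P => (∑ τ : Quotient P ≃ Fin (Fintype.card (Quotient P)),
    (if cond _ (fun v => τ (Quotient.mk P v)) then (1 : ℚ) else 0)) /
      ((Fintype.card (Quotient P)).factorial : ℚ), fun n L => ?_⟩
  set P := Setoid.ker L with hP
  let ι : Quotient P ↪ Fin n := ⟨Setoid.kerLift L, Setoid.kerLift_injective L⟩
  have hι : ∀ v, ι (Quotient.mk P v) = L v := fun v => rfl
  have hA : ∀ τ : Perm (Quotient P),
      ∑ h : Perm (Fin n), (if cond n (⇑h ∘ L) then (1 : ℚ) else 0)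
      = ∑ h : Perm (Fin n),
        (if cond n (fun v => h (ι (τ (Quotient.mk P v)))) then (1 : ℚ) else 0) := by
    intro τ
    symm
    refine Fintype.sum_equiv (Equiv.mulRight (τ.viaFintypeEmbedding ι)) _ _ fun h => ?_
    have : (fun v => h (ι (τ (Quotient.mk P v))))
        = ⇑(Equiv.mulRight (τ.viaFintypeEmbedding ι) h) ∘ L := by
      funext v
      simp only [Function.comp, Equiv.coe_mulRight, Perm.mul_apply]
      rw [← hι v, Perm.viaFintypeEmbedding_apply_image]
    rw [this]
  have hB : ∀ h : Perm (Fin n), ∑ τ : Perm (Quotient P),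
        (if cond n (fun v => h (ι (τ (Quotient.mk P v)))) then (1 : ℚ) else 0)
      = ∑ τ : Quotient P ≃ Fin (Fintype.card (Quotient P)),
        (if cond _ (fun v => τ (Quotient.mk P v)) then (1 : ℚ) else 0) := by
    intro h
    obtain ⟨e, he⟩ := exists_order_equiv (fun x => h (ι x)) (h.injective.comp ι.injective)
    refine Fintype.sum_equiv (Equiv.equivCongr (Equiv.refl _) e) _ _ fun τ => ?_
    refine if_congr (hcond _ _ _ _ fun x y => ?_) rfl rfl
    simp [he]
  have hsum : ((Fintype.card (Quotient P)).factorial : ℚ) *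
      ∑ h : Perm (Fin n), (if cond n (⇑h ∘ L) then (1 : ℚ) else 0)
      = (n.factorial : ℚ) * ∑ τ : Quotient P ≃ Fin (Fintype.card (Quotient P)),
        (if cond _ (fun v => τ (Quotient.mk P v)) then (1 : ℚ) else 0) := by
    calc _ = ∑ _τ : Perm (Quotient P),
          ∑ h : Perm (Fin n), (if cond n (⇑h ∘ L) then (1 : ℚ) else 0) := by
          rw [Finset.sum_const, Finset.card_univ, Fintype.card_perm, nsmul_eq_mul]
      _ = ∑ τ : Perm (Quotient P), ∑ h : Perm (Fin n),
        (if cond n (fun v => h (ι (τ (Quotient.mk P v)))) then (1 : ℚ) else 0) :=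
          Finset.sum_congr rfl fun τ _ => hA τ
      _ = ∑ h : Perm (Fin n), ∑ τ : Perm (Quotient P),
        (if cond n (fun v => h (ι (τ (Quotient.mk P v)))) then (1 : ℚ) else 0) :=
          Finset.sum_comm
      _ = ∑ _h : Perm (Fin n), ∑ τ : Quotient P ≃ Fin (Fintype.card (Quotient P)),
        (if cond _ (fun v => τ (Quotient.mk P v)) then (1 : ℚ) else 0) :=
          Finset.sum_congr rfl fun h _ => hB h
      _ = _ := by
          rw [Finset.sum_const, Finset.card_univ, Fintype.card_perm, nsmul_eq_mul,
            Fintype.card_fin]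
  have hr : ((Fintype.card (Quotient P)).factorial : ℚ) ≠ 0 := by
    exact_mod_cast Nat.factorial_ne_zero _
  rw [← mul_div_assoc, eq_div_iff hr, mul_comm, hsum]

/-- The order condition on the labels, for `d` simultaneous occurrences of `σ`. -/
def patCond {k : ℕ} (d : ℕ) (σ : Fin k → Fin k) (n : ℕ)
    (L : (Fin d × Fin k) ⊕ (Fin d × Fin k) → Fin n) : Prop :=
  ∀ j, StrictMono (fun a => L (Sum.inl (j, a))) ∧ IsSorted σ (fun a => L (Sum.inr (j, a)))

theorem patCond_congr {k : ℕ} (d : ℕ) (σ : Fin k → Fin k) (n m : ℕ)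
    (L : (Fin d × Fin k) ⊕ (Fin d × Fin k) → Fin n)
    (L' : (Fin d × Fin k) ⊕ (Fin d × Fin k) → Fin m)
    (h : ∀ x y, L x < L y ↔ L' x < L' y) : patCond d σ n L ↔ patCond d σ m L' := by
  simp only [patCond, StrictMono, IsSorted, h]

theorem patCount_pow {k : ℕ} (d : ℕ) (σ : Fin k → Fin k) (n : ℕ) (g : Perm (Fin n)) :
    (patCount k n σ g : ℚ) ^ d = ∑ I : Fin d × Fin k → Fin n,
      (if patCond d σ n (Sum.elim I (⇑g ∘ I)) then (1 : ℚ) else 0) := by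
  rw [Finset.sum_boole, ← Fintype.card_subtype, ← Nat.card_eq_fintype_card, ← Nat.cast_pow]
  congr 1
  have : patCount k n σ g ^ d = Nat.card (Fin d →
      {I : Fin k → Fin n // StrictMono I ∧ IsSorted σ (⇑g ∘ I)}) := by
    rw [Nat.card_fun]; simp [patCount]
  rw [this]
  refine Nat.card_congr ⟨fun F => ⟨fun p => (F p.1).1 p.2, fun j => (F j).2⟩,
    fun I j => ⟨fun a => I.1 (j, a), I.2 j⟩, ?_, ?_⟩
  · intro F; rfl
  · intro I; rfl

theorem sum_conj_good (k d : ℕ) (σ : Fin k → Fin k) :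
    ∃ f, Good (d * k) (d * k) f ∧ ∀ n (g : Perm (Fin n)),
      ∑ h : Perm (Fin n), (patCount k n σ (h * g * h⁻¹) : ℚ) ^ d
        = (n.factorial : ℚ) * f n g := by
  obtain ⟨c, hc⟩ := exists_prob (patCond d σ) (fun n m => patCond_congr d σ n m)
  have hK : Fintype.card (Fin d × Fin k) = d * k := by simp
  refine ⟨fun n g => ∑ P : Setoid ((Fin d × Fin k) ⊕ (Fin d × Fin k)),
    c P * ((Finset.univ.filter fun I : Fin d × Fin k → Fin n => kr g I = P).card : ℚ),
    Good.sum _ fun P _ => Good.smul _ ?_, fun n g => ?_⟩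
  · have := good_exact (d * k) (Fin d × Fin k) hK.le P
    rw [hK] at this
    exact this.congr fun n g => by congr; exact Subsingleton.elim _ _
  · calc _ = ∑ h : Perm (Fin n), ∑ I : Fin d × Fin k → Fin n,
          (if patCond d σ n (⇑h ∘ Sum.elim I (⇑g ∘ I)) then (1 : ℚ) else 0) := by
          refine Finset.sum_congr rfl fun h _ => ?_
          rw [patCount_pow]
          symm
          refine Fintype.sum_equiv (Equiv.arrowCongr (Equiv.refl _) h) _ _ fun I => ?_
          refine if_congr (iff_of_eq (congrArg _ ?_)) rfl rfl
          funext v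
          rcases v with v | v <;> simp
      _ = ∑ I : Fin d × Fin k → Fin n, ∑ h : Perm (Fin n),
          (if patCond d σ n (⇑h ∘ Sum.elim I (⇑g ∘ I)) then (1 : ℚ) else 0) :=
          Finset.sum_comm
      _ = ∑ I : Fin d × Fin k → Fin n, (n.factorial : ℚ) * c (kr g I) :=
          Finset.sum_congr rfl fun I _ => hc n _
      _ = _ := by
          rw [← Finset.mul_sum]
          congr 1
          rw [← Finset.sum_fiberwise_of_maps_to (g := kr g) (t := Finset.univ)
            (fun _ _ => Finset.mem_univ _)]
          refine Finset.sum_congr rfl fun P _ => ?_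
          rw [Finset.sum_congr rfl (g := fun _ => c P)
            (fun I hI => by rw [(Finset.mem_filter.1 hI).2])]
          rw [Finset.sum_const, nsmul_eq_mul, mul_comm]

theorem cycleCount_conj {n : ℕ} {g g' : Perm (Fin n)} (h : IsConj g g') (i : ℕ) :
    cycleCount g i = cycleCount g' i := by
  have hct := Perm.isConj_iff_cycleType_eq.1 h
  unfold cycleCount
  rw [hct]
  split_ifs
  · obtain ⟨c, rfl⟩ := isConj_iff.1 h
    refine Nat.card_congr (Equiv.subtypeEquiv c fun x => ?_)
    simp
  · rfl

end PMP

/-- For fixed `σ ∈ S_k` and `d ≥ 1`, there is a polynomial `Q` in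
`x_0, x_1, …, x_{dk}` of weighted degree at most `dk` (weight of `x_0` is 1, of `x_i` is `i`)
such that for all `n` and all `π ∈ S_n`, the sum of `N_σ(π')^d` over the conjugacy class
`C_π` equals `|C_π| · Q(n, m_1(π), …, m_{dk}(π))`. -/
theorem pattern_moment_polynomial (k d : ℕ) (hk : 0 < k) (hd : 0 < d)
    (σ : Equiv.Perm (Fin k)) :
    ∃ Q : MvPolynomial (Fin (d * k + 1)) ℚ,
      MvPolynomial.weightedTotalDegree
          (fun i : Fin (d * k + 1) => if (i : ℕ) = 0 then 1 else (i : ℕ) :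
            Fin (d * k + 1) → ℕ) Q ≤ d * k ∧
      ∀ (n : ℕ), 0 < n → ∀ π : Equiv.Perm (Fin n),
        (∑ π' ∈ Finset.univ.filter (fun π' : Equiv.Perm (Fin n) => IsConj π π'),
            (patCount k n ⇑σ π' : ℚ) ^ d) =
          ((Finset.univ.filter (fun π' : Equiv.Perm (Fin n) => IsConj π π')).card : ℚ) *
            MvPolynomial.eval (fun i : Fin (d * k + 1) =>
              if (i : ℕ) = 0 then (n : ℚ) else (cycleCount π (i : ℕ) : ℚ)) Q := by
  obtain ⟨f, ⟨Q, hQ, hf⟩, hsum⟩ := PMP.sum_conj_good k d σ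
  refine ⟨Q, hQ, fun n _ π => ?_⟩
  set C := Finset.univ.filter (fun π' : Equiv.Perm (Fin n) => IsConj π π') with hC
  have hn : (n.factorial : ℚ) ≠ 0 := by exact_mod_cast Nat.factorial_ne_zero _
  apply mul_left_cancel₀ hn
  have hconst : ∀ π' ∈ C, f n π' = MvPolynomial.eval (PMP.pt (d * k) n π) Q := by
    intro π' hπ'
    rw [hf]
    congr 2
    funext i
    simp only [PMP.pt]
    rw [PMP.cycleCount_conj (Finset.mem_filter.1 hπ').2]
  have hshift : ∀ h : Equiv.Perm (Fin n), ∑ π' ∈ C, (patCount k n ⇑σ (h * π' * h⁻¹) : ℚ) ^ d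
      = ∑ π' ∈ C, (patCount k n ⇑σ π' : ℚ) ^ d := by
    intro h
    refine Finset.sum_equiv (MulAut.conj h).toEquiv (fun π' => ?_) (fun π' _ => ?_)
    · simp only [hC, Finset.mem_filter, Finset.mem_univ, true_and]
      have hc : IsConj π' (h * π' * h⁻¹) := isConj_iff.2 ⟨h, rfl⟩
      exact ⟨fun h1 => h1.trans hc, fun h1 => h1.trans hc.symm⟩
    · rfl
  calc (n.factorial : ℚ) * ∑ π' ∈ C, (patCount k n ⇑σ π' : ℚ) ^ d
      = ∑ h : Equiv.Perm (Fin n), ∑ π' ∈ C, (patCount k n ⇑σ (h * π' * h⁻¹) : ℚ) ^ d := by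
        rw [Finset.sum_congr rfl fun h _ => hshift h, Finset.sum_const, Finset.card_univ,
          Fintype.card_perm, nsmul_eq_mul, Fintype.card_fin]
    _ = ∑ π' ∈ C, ∑ h : Equiv.Perm (Fin n), (patCount k n ⇑σ (h * π' * h⁻¹) : ℚ) ^ d :=
        Finset.sum_comm
    _ = ∑ π' ∈ C, (n.factorial : ℚ) * MvPolynomial.eval (PMP.pt (d * k) n π) Q :=
        Finset.sum_congr rfl fun π' hπ' => by rw [hsum, hconst π' hπ']
    _ = _ := by
        rw [Finset.sum_const, nsmul_eq_mul, mul_left_comm]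
        rfl
end
end

section
/- Fix a positive integer k and a set partition P of Fin k ⊕ Fin k. There exists a multivariate polynomial Q with rational coefficients in the variables x_0, x_1, …, x_k, whose weighted total degree is at most k when x_0 is given weight 1 and x_i is given weight i for i ≥ 1, such that for every positive integer n and every g ∈ S_n, the trace of the endomorphism ρ(g) ∘ T_P of W_{k,n} equals Q(n, m_1(g), m_2(g), …, m_k(g)). Equivalently, Σ_{I : Fin k → Fin n} C_P(g⁻¹ ∘ I, I) = Q(n, m_1(g), …, m_k(g)). -/
/-!
Formalization of statements from "Stable characters from permutation patterns"
by C. Gaetz and C. Ryba.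
-/

open scoped Classical

noncomputable section

/-- The weights on the variables. -/
def wt (k : ℕ) : Fin (k + 1) → ℕ := fun i => if (i : ℕ) = 0 then 1 else (i : ℕ)

/-- The evaluation point attached to a permutation. -/
def pt (k : ℕ) {n : ℕ} (g : Equiv.Perm (Fin n)) : Fin (k + 1) → ℚ :=
  fun i => if (i : ℕ) = 0 then (n : ℚ) else (cycleCount g (i : ℕ) : ℚ)

/-- `F` is given by a polynomial of weighted degree at most `m`. -/
def Good (k m : ℕ) (F : ∀ n : ℕ, Equiv.Perm (Fin n) → ℕ) : Prop :=
  ∃ Q : MvPolynomial (Fin (k + 1)) ℚ, (∀ d ∈ Q.support, Finsupp.weight (wt k) d ≤ m) ∧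
    ∀ (n : ℕ) (g : Equiv.Perm (Fin n)), (F n g : ℚ) = MvPolynomial.eval (pt k g) Q

theorem Good.mono {k m m' : ℕ} {F : ∀ n : ℕ, Equiv.Perm (Fin n) → ℕ} (h : Good k m F)
    (hm : m ≤ m') : Good k m' F := by
  obtain ⟨Q, h1, h2⟩ := h
  exact ⟨Q, fun d hd => (h1 d hd).trans hm, h2⟩

theorem Good.one (k : ℕ) : Good k 0 (fun _ _ => 1) := by
  refine ⟨1, ?_, by simp⟩
  intro d hd
  have : d = 0 := by
    by_contra h
    rw [MvPolynomial.mem_support_iff, MvPolynomial.coeff_one, if_neg (Ne.symm h)] at hd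
    exact hd rfl
  simp [this]

theorem Good.mul {k m m' : ℕ} {F G : ∀ n : ℕ, Equiv.Perm (Fin n) → ℕ} (h : Good k m F)
    (h' : Good k m' G) : Good k (m + m') (fun n g => F n g * G n g) := by
  obtain ⟨Q, h1, h2⟩ := h
  obtain ⟨Q', h1', h2'⟩ := h'
  refine ⟨Q * Q', ?_, ?_⟩
  · intro d hd
    have := MvPolynomial.support_mul Q Q' hd
    obtain ⟨a, ha, b, hb, rfl⟩ := Finset.mem_add.1 this
    rw [map_add]
    exact add_le_add (h1 a ha) (h1' b hb)
  · intro n g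
    push_cast
    rw [map_mul, h2, h2']

theorem Good.add {k m : ℕ} {F G : ∀ n : ℕ, Equiv.Perm (Fin n) → ℕ} (h : Good k m F)
    (h' : Good k m G) : Good k m (fun n g => F n g + G n g) := by
  obtain ⟨Q, h1, h2⟩ := h
  obtain ⟨Q', h1', h2'⟩ := h'
  refine ⟨Q + Q', ?_, ?_⟩
  · intro d hd
    rcases Finset.mem_union.1 (MvPolynomial.support_add hd) with h | h
    · exact h1 d h
    · exact h1' d h
  · intro n g
    push_cast
    rw [map_add, h2, h2']

theorem Good.zero (k m : ℕ) : Good k m (fun _ _ => 0) := ⟨0, by simp, by simp⟩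

theorem Good.sum {ι : Type*} {k m : ℕ} (s : Finset ι) (F : ι → ∀ n : ℕ, Equiv.Perm (Fin n) → ℕ)
    (h : ∀ i ∈ s, Good k m (F i)) : Good k m (fun n g => ∑ i ∈ s, F i n g) := by
  induction s using Finset.induction_on with
  | empty => simpa using Good.zero k m
  | insert a s ha ih =>
    simp only [Finset.sum_insert ha]
    exact (h a (by simp)).add (ih fun i hi => h i (by simp [hi]))

theorem Good.const (k c : ℕ) : Good k 0 (fun _ _ => c) := by
  induction c with
  | zero => exact Good.zero k 0
  | succ c ih => exact ih.add (Good.one k)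

theorem Good.X (k : ℕ) (i : Fin (k + 1)) (F : ∀ n : ℕ, Equiv.Perm (Fin n) → ℕ)
    (hF : ∀ n (g : Equiv.Perm (Fin n)), (F n g : ℚ) = pt k g i) : Good k (wt k i) F := by
  refine ⟨MvPolynomial.X i, ?_, by simpa using hF⟩
  intro d hd
  rw [MvPolynomial.support_X, Finset.mem_singleton] at hd
  simp [hd, Finsupp.weight_single]

theorem Good.n (k : ℕ) : Good k 1 (fun n _ => n) := by
  simpa [wt] using Good.X k 0 (fun n _ => n) (by simp [pt])

theorem Good.cyc (k e : ℕ) (he : 0 < e) (hek : e ≤ k) : Good k e (fun _ g => cycleCount g e) := by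
  have := Good.X k ⟨e, by omega⟩ (fun _ g => cycleCount g e) (by simp [pt, he.ne'])
  simpa [wt, he.ne'] using this

theorem pow_fix_iff {n : ℕ} (g : Equiv.Perm (Fin n)) (d : ℕ) (y : Fin n) (hy : g y ≠ y) :
    (g ^ d) y = y ↔ (g.cycleOf y).support.card ∣ d := by
  have hc := Equiv.Perm.isCycle_cycleOf g hy
  rw [← hc.orderOf, orderOf_dvd_iff_pow_eq_one, hc.pow_eq_one_iff' (x := y) (by simpa using hy),
    Equiv.Perm.cycleOf_pow_apply_self]

theorem card_len {n : ℕ} (g : Equiv.Perm (Fin n)) (e : ℕ) :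
    (Finset.univ.filter fun y => g y ≠ y ∧ (g.cycleOf y).support.card = e).card =
      e * Multiset.count e g.cycleType := by
  have h1 : (Finset.univ.filter fun y => g y ≠ y ∧ (g.cycleOf y).support.card = e) =
      (g.cycleFactorsFinset.filter fun c => c.support.card = e).biUnion
        fun c => c.support := by
    ext y
    simp only [Finset.mem_filter, Finset.mem_univ, true_and, Finset.mem_biUnion]
    constructor
    · rintro ⟨hy, he⟩
      refine ⟨g.cycleOf y, ⟨Equiv.Perm.cycleOf_mem_cycleFactorsFinset_iff.2 (by simpa using hy), he⟩, ?_⟩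
      simpa using hy
    · rintro ⟨c, ⟨hc, he⟩, hy⟩
      have := Equiv.Perm.cycle_is_cycleOf hy hc
      subst this
      exact ⟨by simpa using hy, he⟩
  rw [h1, Finset.card_biUnion]
  · rw [Finset.sum_congr rfl (g := fun _ => e) (by
      intro c hc
      exact (Finset.mem_filter.1 hc).2)]
    rw [Finset.sum_const, Equiv.Perm.cycleType_def, Multiset.count_map, smul_eq_mul, mul_comm]
    congr 1
    simp only [Finset.card, Finset.filter_val, Function.comp_def, eq_comm]
    congr
  · intro c hc c' hc' hne
    have := Equiv.Perm.cycleFactorsFinset_pairwise_disjoint g (Finset.mem_filter.1 hc).1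
      (Finset.mem_filter.1 hc').1 hne
    exact this.disjoint_support

theorem card_fix {n : ℕ} (g : Equiv.Perm (Fin n)) (d : ℕ) (hd : 0 < d) :
    Nat.card {y : Fin n // (g ^ d) y = y} = ∑ e ∈ d.divisors, e * cycleCount g e := by
  have h2 : ∀ e, e * cycleCount g e = (if e = 1 then Nat.card {x : Fin n // g x = x} else 0) +
      (Finset.univ.filter fun y => g y ≠ y ∧ (g.cycleOf y).support.card = e).card := by
    intro e
    rw [card_len]
    unfold cycleCount
    split_ifs with h
    · subst h
      have : Multiset.count 1 g.cycleType = 0 := by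
        rw [Multiset.count_eq_zero]
        intro h
        have := Equiv.Perm.two_le_of_mem_cycleType h
        omega
      simp [this]
    · simp
  simp_rw [h2]
  rw [Finset.sum_add_distrib, Finset.sum_ite_eq', if_pos (by simp [hd.ne'])]
  rw [← Finset.card_biUnion]
  · rw [Nat.card_eq_fintype_card, Nat.card_eq_fintype_card, Fintype.card_subtype,
      Fintype.card_subtype, ← Finset.card_union_of_disjoint]
    · congr 1
      ext y
      simp only [Finset.mem_filter, Finset.mem_univ, true_and, Finset.mem_union,
        Finset.mem_biUnion]
      by_cases hy : g y = y
      · simp only [hy, true_or, iff_true]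
        exact Equiv.Perm.pow_apply_eq_self_of_apply_eq_self hy d
      · rw [pow_fix_iff g d y hy]
        simp [hy, hd.ne']
    · rw [Finset.disjoint_left]
      intro y hy
      simp only [Finset.mem_filter, Finset.mem_univ, true_and] at hy
      simp [hy]
  · intro a _ b _ hab
    simp only [Function.onFun]
    rw [Finset.disjoint_left]
    intro y hy hy'
    simp only [Finset.mem_filter, Finset.mem_univ, true_and] at hy hy'
    exact hab (hy.2.symm.trans hy'.2)

theorem Good.fix (k d : ℕ) (hd : 0 < d) (hdk : d ≤ k) :
    Good k d (fun n g => Nat.card {y : Fin n // (⇑g)^[d] y = y}) := by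
  have h : Good k d (fun n g => ∑ e ∈ d.divisors, e * cycleCount g e) := by
    apply Good.sum
    intro e he
    have h1 := Nat.divisor_le he
    have h2 := Nat.pos_of_mem_divisors he
    exact ((Good.const k e).mul (Good.cyc k e h2 (by omega))).mono (by omega)
  have e : (fun n (g : Equiv.Perm (Fin n)) => Nat.card {y : Fin n // (⇑g)^[d] y = y}) =
      (fun n g => ∑ e ∈ d.divisors, e * cycleCount g e) := by
    funext n g
    rw [← card_fix g d hd]
    simp [Equiv.Perm.iterate_eq_pow]
  rw [e]
  exact h

/-- A word satisfying the equality constraints `E` and the `g`-constraints `R`. -/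
def IsSol {V : Type} (E R : V → V → Prop) {n : ℕ} (g : Equiv.Perm (Fin n)) (x : V → Fin n) : Prop :=
  (∀ i j, E i j → x i = x j) ∧ ∀ i j, R i j → x j = g (x i)

theorem card_contract {V : Type} (E R : V → V → Prop) (S : V → V → Prop) {n : ℕ}
    (g : Equiv.Perm (Fin n)) (hS : ∀ x : V → Fin n, IsSol E R g x → ∀ i j, S i j → x i = x j) :
    Nat.card {x : V → Fin n // IsSol E R g x} =
    Nat.card {x : Quot S → Fin n // IsSol
      (fun a b => ∃ i j, Quot.mk S i = a ∧ Quot.mk S j = b ∧ E i j)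
      (fun a b => ∃ i j, Quot.mk S i = a ∧ Quot.mk S j = b ∧ R i j) g x} := by
  symm
  refine Nat.card_eq_of_bijective
    (fun x => ⟨fun v => x.1 (Quot.mk S v), ?_, ?_⟩) ⟨?_, ?_⟩
  · intro i j h
    exact x.2.1 _ _ ⟨i, j, rfl, rfl, h⟩
  · intro i j h
    exact x.2.2 _ _ ⟨i, j, rfl, rfl, h⟩
  · rintro ⟨x, hx⟩ ⟨y, hy⟩ h
    apply Subtype.ext
    funext a
    induction a using Quot.ind with
    | mk v => exact congrFun (congrArg Subtype.val h) v
  · rintro ⟨x, hx⟩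
    refine ⟨⟨Quot.lift x (hS x hx), ?_, ?_⟩, rfl⟩
    · rintro _ _ ⟨i, j, rfl, rfl, h⟩
      exact hx.1 i j h
    · rintro _ _ ⟨i, j, rfl, rfl, h⟩
      exact hx.2 i j h

theorem card_leaf {V : Type} (R : V → V → Prop) (u v : V) (huv : R u v)
    (hin : ∀ w, R w v → w = u) (hout : ∀ w, ¬ R v w) {n : ℕ} (g : Equiv.Perm (Fin n)) :
    Nat.card {x : V → Fin n // IsSol (fun _ _ => False) R g x} =
    Nat.card {x : {w // w ≠ v} → Fin n // IsSol (fun _ _ => False) (fun a b => R a.1 b.1) g x} := by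
  have hne : u ≠ v := fun h => hout v (h ▸ huv)
  refine Nat.card_eq_of_bijective
    (fun x => ⟨fun w => x.1 w.1, fun _ _ h => h.elim, fun i j h => x.2.2 _ _ h⟩) ⟨?_, ?_⟩
  · rintro ⟨x, hx⟩ ⟨y, hy⟩ h
    have h' : ∀ w, w ≠ v → x w = y w := fun w hw => congrFun (congrArg Subtype.val h) ⟨w, hw⟩
    apply Subtype.ext
    funext w
    by_cases hw : w = v
    · subst hw
      change x w = y w
      rw [hx.2 _ _ huv, hy.2 _ _ huv, h' u hne]
    · exact h' w hw
  · rintro ⟨x, hx⟩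
    refine ⟨⟨fun w => if h : w = v then g (x ⟨u, hne⟩) else x ⟨w, h⟩, fun _ _ h => h.elim, ?_⟩, ?_⟩
    · intro i j h
      have hi : i ≠ v := fun e => hout j (e ▸ h)
      by_cases hj : j = v
      · subst hj
        have := hin i h
        subst this
        simp [hi]
      · simp only [hi, hj, dite_false]
        exact hx.2 ⟨i, hi⟩ ⟨j, hj⟩ h
    · apply Subtype.ext
      funext w
      simp [w.2]

theorem card_isolated {V : Type} (R : V → V → Prop) (v : V)
    (hin : ∀ w, ¬ R w v) (hout : ∀ w, ¬ R v w) {n : ℕ} (g : Equiv.Perm (Fin n)) :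
    Nat.card {x : V → Fin n // IsSol (fun _ _ => False) R g x} =
    n * Nat.card {x : {w // w ≠ v} → Fin n // IsSol (fun _ _ => False) (fun a b => R a.1 b.1) g x} := by
  have : n = Nat.card (Fin n) := by simp
  refine Eq.trans ?_ (congrArg (· * _) this.symm)
  beta_reduce
  rw [← Nat.card_prod]
  refine Nat.card_eq_of_bijective
    (fun x => (x.1 v, ⟨fun w => x.1 w.1, fun _ _ h => h.elim, fun i j h => x.2.2 _ _ h⟩)) ⟨?_, ?_⟩
  · rintro ⟨x, hx⟩ ⟨y, hy⟩ h
    have h0 := congrArg Prod.fst h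
    have h' : ∀ w, w ≠ v → x w = y w := fun w hw =>
      congrFun (congrArg Subtype.val (congrArg Prod.snd h)) ⟨w, hw⟩
    apply Subtype.ext
    funext w
    by_cases hw : w = v
    · subst hw
      exact h0
    · exact h' w hw
  · rintro ⟨y, x, hx⟩
    refine ⟨⟨fun w => if h : w = v then y else x ⟨w, h⟩, fun _ _ h => h.elim, ?_⟩, ?_⟩
    · intro i j h
      have hi : i ≠ v := fun e => hout j (e ▸ h)
      have hj : j ≠ v := fun e => hin i (e ▸ h)
      simp only [hi, hj, dite_false]
      exact hx.2 ⟨i, hi⟩ ⟨j, hj⟩ h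
    · refine Prod.ext (by simp) ?_
      apply Subtype.ext
      funext w
      simp [w.2]

theorem card_cycle {V : Type} [Finite V] (R : V → V → Prop) (s : V → V) (hs : s.Injective)
    (hR : ∀ i j, R i j ↔ j = s i) (v : V) {n : ℕ} (g : Equiv.Perm (Fin n)) :
    Nat.card {x : V → Fin n // IsSol (fun _ _ => False) R g x} =
    Nat.card {y : Fin n // (⇑g)^[Function.minimalPeriod s v] y = y} *
    Nat.card {x : {w // ¬ ∃ m : ℕ, s^[m] v = w} → Fin n //
      IsSol (fun _ _ => False) (fun a b => R a.1 b.1) g x} := by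
  have hp : 0 < Function.minimalPeriod s v :=
    Function.minimalPeriod_pos_of_mem_periodicPts (hs.mem_periodicPts v)
  rw [← Nat.card_prod]
  have key : ∀ x : V → Fin n, IsSol (fun _ _ => False) R g x → ∀ m : ℕ,
      x (s^[m] v) = (⇑g)^[m] (x v) := by
    intro x hx m
    induction m with
    | zero => rfl
    | succ m ih =>
      rw [Function.iterate_succ_apply', Function.iterate_succ_apply', ← ih]
      exact hx.2 _ _ ((hR _ _).2 rfl)
  have well : ∀ y : Fin n, (⇑g)^[Function.minimalPeriod s v] y = y → ∀ m m' : ℕ,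
      s^[m] v = s^[m'] v → (⇑g)^[m] y = (⇑g)^[m'] y := by
    intro y hy m m' h
    rw [← Function.iterate_mod_minimalPeriod_eq (n := m),
      ← Function.iterate_mod_minimalPeriod_eq (n := m'),
      Function.iterate_eq_iterate_iff_of_lt_minimalPeriod (Nat.mod_lt _ hp) (Nat.mod_lt _ hp)] at h
    have hy' : Function.IsPeriodicPt (⇑g) (Function.minimalPeriod s v) y := hy
    rw [← hy'.iterate_mod_apply m, ← hy'.iterate_mod_apply m', h]
  refine Nat.card_eq_of_bijective
    (fun x => (⟨x.1 v, ?_⟩,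
      ⟨fun w => x.1 w.1, fun _ _ h => h.elim, fun i j h => x.2.2 _ _ h⟩)) ⟨?_, ?_⟩
  · rw [← key x.1 x.2, Function.iterate_minimalPeriod]
  · rintro ⟨x, hx⟩ ⟨y, hy⟩ h
    have h0 : x v = y v := congrArg Subtype.val (congrArg Prod.fst h)
    have h' : ∀ w, (¬ ∃ m : ℕ, s^[m] v = w) → x w = y w := fun w hw =>
      congrFun (congrArg Subtype.val (congrArg Prod.snd h)) ⟨w, hw⟩
    apply Subtype.ext
    funext w
    by_cases hw : ∃ m : ℕ, s^[m] v = w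
    · obtain ⟨m, rfl⟩ := hw
      change x _ = y _
      rw [key x hx, key y hy, h0]
    · exact h' w hw
  · rintro ⟨⟨y, hy⟩, x, hx⟩
    let z : V → Fin n := fun w =>
      if h : ∃ m : ℕ, s^[m] v = w then (⇑g)^[h.choose] y else x ⟨w, h⟩
    have hz1 : ∀ m : ℕ, z (s^[m] v) = (⇑g)^[m] y := by
      intro m
      have h : ∃ m' : ℕ, s^[m'] v = s^[m] v := ⟨m, rfl⟩
      simp only [z, h, dite_true]
      exact well y hy _ _ h.choose_spec
    have hz2 : ∀ w (h : ¬ ∃ m : ℕ, s^[m] v = w), z w = x ⟨w, h⟩ := by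
      intro w h
      simp only [z, h, dite_false]
    refine ⟨⟨z, fun _ _ h => h.elim, ?_⟩, ?_⟩
    · intro i j hij
      obtain rfl := (hR i j).1 hij
      by_cases hi : ∃ m : ℕ, s^[m] v = i
      · obtain ⟨m, rfl⟩ := hi
        rw [← Function.iterate_succ_apply' s, hz1, hz1, Function.iterate_succ_apply']
      · have hj : ¬ ∃ m : ℕ, s^[m] v = s i := by
          rintro ⟨m, hm⟩
          apply hi
          refine ⟨m + Function.minimalPeriod s v - 1, hs ?_⟩
          rw [← Function.iterate_succ_apply' s, ← hm,
            ← Function.iterate_add_minimalPeriod_eq (n := m)]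
          congr 2
          omega
        rw [hz2 _ hi, hz2 _ hj]
        exact hx.2 ⟨i, hi⟩ ⟨s i, hj⟩ hij
    · refine Prod.ext (Subtype.ext (hz1 0)) ?_
      apply Subtype.ext
      funext w
      exact hz2 w.1 w.2

theorem card_quot_lt {V : Type} [Finite V] (i j : V) (h : i ≠ j) :
    Nat.card (Quot fun a b => a = i ∧ b = j) < Nat.card V := by
  refine lt_of_le_of_ne (Nat.card_le_card_of_surjective _ Quot.mk_surjective) fun e => h ?_
  have hb := (Nat.bijective_iff_surjective_and_card (Quot.mk fun a b => a = i ∧ b = j)).2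
    ⟨Quot.mk_surjective, e.symm⟩
  exact hb.1 (Quot.sound ⟨rfl, rfl⟩)

theorem good_main (k N : ℕ) : ∀ (V : Type) [Finite V] (E R : V → V → Prop), Nat.card V = N →
    N ≤ k → Good k N (fun n g => Nat.card {x : V → Fin n // IsSol E R g x}) := by
  induction N using Nat.strong_induction_on with
  | _ N ih =>
  intro V _ E R hV hN
  by_cases hc : ∃ i j : V, i ≠ j ∧ ∀ (n : ℕ) (g : Equiv.Perm (Fin n)) (x : V → Fin n),
      IsSol E R g x → x i = x j
  · obtain ⟨i, j, hij, h⟩ := hc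
    have hlt := card_quot_lt i j hij
    have := (ih _ (hV ▸ hlt) (Quot fun a b => a = i ∧ b = j)
      (fun a b => ∃ i' j', Quot.mk _ i' = a ∧ Quot.mk _ j' = b ∧ E i' j')
      (fun a b => ∃ i' j', Quot.mk _ i' = a ∧ Quot.mk _ j' = b ∧ R i' j') rfl (by omega)).mono
      (m' := N) (by omega)
    convert this using 3 with n g
    apply card_contract E R _ g
    rintro x hx a b ⟨rfl, rfl⟩
    exact h n g x hx
  push Not at hc
  have hE : ∀ i j, E i j → i = j := by
    intro i j h
    by_contra hne
    obtain ⟨n, g, x, hx, hxx⟩ := hc i j hne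
    exact hxx (hx.1 i j h)
  have hR1 : ∀ a i j, R a i → R a j → i = j := by
    intro a i j h h'
    by_contra hne
    obtain ⟨n, g, x, hx, hxx⟩ := hc i j hne
    exact hxx ((hx.2 _ _ h).trans (hx.2 _ _ h').symm)
  have hR2 : ∀ a i j, R i a → R j a → i = j := by
    intro a i j h h'
    by_contra hne
    obtain ⟨n, g, x, hx, hxx⟩ := hc i j hne
    exact hxx (g.injective ((hx.2 _ _ h).symm.trans (hx.2 _ _ h')))
  have hES : ∀ (n : ℕ) (g : Equiv.Perm (Fin n)) (x : V → Fin n),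
      IsSol E R g x ↔ IsSol (fun _ _ => False) R g x := by
    intro n g x
    constructor
    · exact fun h => ⟨fun _ _ h => h.elim, h.2⟩
    · exact fun h => ⟨fun i j hij => by rw [hE i j hij], h.2⟩
  simp only [hES]
  by_cases hv : ∃ v, ∀ w, ¬ R v w
  · obtain ⟨v, hout⟩ := hv
    have hlt : Nat.card {w // w ≠ v} + 1 = N := by
      have := Fintype.ofFinite V
      have h0 : 0 < Fintype.card V := Fintype.card_pos_iff.2 ⟨v⟩
      rw [← hV, Nat.card_eq_fintype_card, Nat.card_eq_fintype_card, Fintype.card_subtype_compl,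
        Fintype.card_subtype_eq]
      omega
    have hg := ih _ (by omega) {w // w ≠ v} (fun _ _ => False) (fun a b => R a.1 b.1) rfl (by omega)
    by_cases hin : ∃ u, R u v
    · obtain ⟨u, hu⟩ := hin
      have := hg.mono (m' := N) (by omega)
      convert this using 3 with n g
      exact card_leaf R u v hu (fun w hw => hR2 _ _ _ hw hu) hout g
    · push Not at hin
      have := ((Good.n k).mul hg).mono (m' := N) (by omega)
      convert this using 3 with n g
      exact card_isolated R v hin hout g
  push Not at hv
  choose s hs using hv
  have hR : ∀ i j, R i j ↔ j = s i := fun i j =>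
    ⟨fun h => hR1 _ _ _ h (hs i), fun h => h ▸ hs i⟩
  have hinj : s.Injective := by
    intro i j h
    exact hR2 _ _ _ (hs i) (h ▸ hs j)
  rcases isEmpty_or_nonempty V with hemp | ⟨⟨v⟩⟩
  · have := (Good.one k).mono (m' := N) (by omega)
    convert this using 3 with n g
    rw [Nat.card_eq_one_iff_unique]
    refine ⟨⟨fun a b => Subtype.ext (funext fun v => hemp.elim v)⟩,
      ⟨⟨fun v => hemp.elim v, fun i => hemp.elim i, fun i => hemp.elim i⟩⟩⟩
  · have hp : 0 < Function.minimalPeriod s v :=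
      Function.minimalPeriod_pos_of_mem_periodicPts (hinj.mem_periodicPts v)
    have hle : Function.minimalPeriod s v + Nat.card {w // ¬ ∃ m : ℕ, s^[m] v = w} ≤ N := by
      have := Nat.card_le_card_of_injective
        (Sum.elim (fun m : Fin (Function.minimalPeriod s v) => s^[m] v)
          (fun w : {w // ¬ ∃ m : ℕ, s^[m] v = w} => w.1)) (by
          rintro (a | a) (b | b) h
          · simp only [Sum.elim_inl] at h
            rw [Function.iterate_eq_iterate_iff_of_lt_minimalPeriod a.2 b.2] at h
            rw [Fin.ext h]
          · exact (b.2 ⟨a, h⟩).elim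
          · exact (a.2 ⟨b, h.symm⟩).elim
          · exact congrArg _ (Subtype.ext h))
      rw [Nat.card_sum, hV] at this
      simpa using this
    have hg := ih _ (by omega) {w // ¬ ∃ m : ℕ, s^[m] v = w} (fun _ _ => False)
      (fun a b => R a.1 b.1) rfl (by omega)
    have := ((Good.fix k _ hp (by omega)).mul hg).mono hle
    convert this using 3 with n g
    exact card_cycle R s hinj hR v g

theorem trace_eq (k n : ℕ) (P : Setoid (Fin k ⊕ Fin k)) (g : Equiv.Perm (Fin n)) :
    LinearMap.trace ℂ (W k n) ((rho k n g) ∘ₗ (TP k n P)) =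
      ∑ I : Fin k → Fin n, CP P (⇑g⁻¹ ∘ I) I := by
  rw [LinearMap.trace_eq_matrix_trace ℂ (Pi.basisFun ℂ (Fin k → Fin n)), Matrix.trace]
  refine Finset.sum_congr rfl fun I _ => ?_
  rw [Matrix.diag_apply, LinearMap.toMatrix_apply]
  simp [rho, TP, Matrix.mulVec_single]

/-- For a fixed set partition `P` of `Fin k ⊕ Fin k`, there is a polynomial
`Q` in `x_0, …, x_k` of weighted degree at most `k` (weight of `x_0` is 1, of `x_i` is `i`)
such that for all `n` and `g ∈ S_n`, the trace of `ρ(g) ∘ T_P` on `W_{k,n}` equals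
`Q(n, m_1(g), …, m_k(g))`. -/
theorem bicharacter_polynomial (k : ℕ) (hk : 0 < k) (P : Setoid (Fin k ⊕ Fin k)) :
    ∃ Q : MvPolynomial (Fin (k + 1)) ℚ,
      MvPolynomial.weightedTotalDegree
          (fun i : Fin (k + 1) => if (i : ℕ) = 0 then 1 else (i : ℕ) :
            Fin (k + 1) → ℕ) Q ≤ k ∧
      ∀ n : ℕ, 0 < n → ∀ g : Equiv.Perm (Fin n),
        LinearMap.trace ℂ (W k n) ((rho k n g) ∘ₗ (TP k n P)) =
          ((MvPolynomial.eval (fun i : Fin (k + 1) =>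
            if (i : ℕ) = 0 then (n : ℚ) else (cycleCount g (i : ℕ) : ℚ)) Q : ℚ) : ℂ) := by
  obtain ⟨Q, h1, h2⟩ := good_main k k (Fin k)
    (fun i j => P.r (Sum.inr i) (Sum.inr j) ∨ P.r (Sum.inl i) (Sum.inl j))
    (fun i j => P.r (Sum.inl j) (Sum.inr i)) (by simp) le_rfl
  refine ⟨Q, Finset.sup_le h1, ?_⟩
  intro n _ g
  have h3 := h2 n g
  change _ = ((MvPolynomial.eval (pt k g) Q : ℚ) : ℂ)
  rw [← h3, trace_eq]
  simp only [CP]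
  rw [Finset.sum_boole, Nat.card_eq_fintype_card, Fintype.card_subtype]
  push_cast
  congr 2
  ext I
  rw [Finset.mem_filter, Finset.mem_filter]
  simp only [Finset.mem_univ, true_and, label, IsSol]
  constructor
  · intro h
    refine ⟨?_, ?_⟩
    · rintro i j (hij | hij)
      · exact h _ _ hij
      · exact g⁻¹.injective (h _ _ hij)
    · intro i j hij
      have : g⁻¹ (I j) = I i := h _ _ hij
      rw [← this]
      simp
  · rintro ⟨hE, hR⟩ (a | a) (b | b) hab
    · simp [hE a b (Or.inr hab)]
    · simp [hR b a hab]
    · simp [hR a b (P.symm hab)]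
    · exact hE a b (Or.inl hab)
end
end
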